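/- Suppose J_O : ℝⁿ → ℝ is Lipschitz with constant λ on the closure of D, is C¹ on D, and is a first integral of the averaged field, i.e. dJ_O(x)(G(x)) = 0 for all x ∈ D. Then there exist constants C > 0 and ε₀ > 0 such that for every ε ∈ (0, ε₀], every solution (φ(t), I(t)) of the perturbed system with I(0) ∈ D for which both I(t) and the solution J(t) of J' = εG(J) with J(0) = I(0) remain in D for 0 ≤ t ≤ 1/ε, satisfies |J_O(I(t)) − J_O(I(0))| ≤ C ε for all 0 ≤ t ≤ 1/ε; that is, J_O is an adiabatic invariant of the perturbed system. -/

import Mathlib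

open Real Set intervalIntegral

/-- An integral over a fixed interval of a `C¹` integrand is a `C¹` function of the parameter. -/
theorem contDiff_one_parametric_intervalIntegral
    {X E : Type*} [NormedAddCommGroup X] [NormedSpace ℝ X] [ProperSpace X]
    [NormedAddCommGroup E] [NormedSpace ℝ E] {F : X × ℝ → E} (hF : ContDiff ℝ 1 F) (a b : ℝ) :
    ContDiff ℝ 1 (fun x => ∫ s in a..b, F (x, s)) := by
  have hF' : Continuous (fderiv ℝ F) := hF.continuous_fderiv one_ne_zero
  have hFc : Continuous F := hF.continuous
  let F' : X → ℝ → X →L[ℝ] E := fun x s => (fderiv ℝ F (x, s)).comp (.inl ℝ X ℝ)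
  have hF'c : Continuous (Function.uncurry F') := by
    change Continuous fun p : X × ℝ => (fderiv ℝ F (p.1, p.2)).comp (.inl ℝ X ℝ)
    fun_prop
  refine contDiff_one_iff_hasFDerivAt.2 ⟨fun x => ∫ s in a..b, F' x s,
    continuous_parametric_intervalIntegral_of_continuous' hF'c a b, fun x₀ => ?_⟩
  obtain ⟨C, hC⟩ := ((isCompact_closedBall x₀ 1).prod (isCompact_uIcc (a := a) (b := b)))
    |>.exists_bound_of_continuousOn hF'c.continuousOn
  refine (hasFDerivAt_integral_of_dominated_of_fderiv_le (F := fun x s => F (x, s)) (F' := F')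
    (bound := fun _ => C) (Metric.closedBall_mem_nhds x₀ one_pos) (.of_forall fun x => ?_)
    ?_ ?_ (.of_forall fun s hs x hx => ?_) ?_ (.of_forall fun s _ x _ => ?_))
  · exact (hFc.comp (by fun_prop : Continuous fun s : ℝ => (x, s))).aestronglyMeasurable
  · exact (hFc.comp (by fun_prop : Continuous fun s : ℝ => (x₀, s))).intervalIntegrable _ _
  · exact (hF'c.comp (by fun_prop : Continuous fun s : ℝ => (x₀, s))).aestronglyMeasurable
  · exact hC (x, s) ⟨hx, uIoc_subset_uIcc hs⟩
  · exact intervalIntegrable_const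
  · exact ((hF.differentiable one_ne_zero (x, s)).hasFDerivAt).comp x
      (hasFDerivAt_prodMk_left x s)

/-- A function of `(x, θ)` which is continuous on `K × ℝ` with `K` compact and periodic in `θ`
is bounded on `K × ℝ`. -/
theorem IsCompact.exists_bound_of_continuousOn_of_periodic
    {X E : Type*} [TopologicalSpace X] [SeminormedAddCommGroup E] {K : Set X} (hK : IsCompact K)
    {u : X × ℝ → E} (hu : ContinuousOn u (K ×ˢ univ)) {T : ℝ} (hT : 0 < T)
    (hper : ∀ x, Function.Periodic (fun θ => u (x, θ)) T) :
    ∃ M, ∀ x ∈ K, ∀ θ, ‖u (x, θ)‖ ≤ M := by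
  obtain ⟨M, hM⟩ := (hK.prod (isCompact_Icc (a := 0) (b := T))).exists_bound_of_continuousOn
    (hu.mono (prod_mono_right (subset_univ _)))
  refine ⟨M, fun x hx θ => ?_⟩
  obtain ⟨y, hy, h⟩ := (hper x).exists_mem_Ico₀ hT θ
  rw [h]
  exact hM (x, y) ⟨hx, Ico_subset_Icc_self hy⟩

/-- The primitive in `θ` of a `C¹` function `k (x, θ)` which is periodic with zero mean in `θ` is
`C¹` and periodic. -/
theorem contDiff_primitive_of_periodic
    {X E : Type*} [NormedAddCommGroup X] [NormedSpace ℝ X] [ProperSpace X]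
    [NormedAddCommGroup E] [NormedSpace ℝ E] [CompleteSpace E]
    {k : X × ℝ → E} (hk : ContDiff ℝ 1 k) {T : ℝ}
    (hper : ∀ x, Function.Periodic (fun θ => k (x, θ)) T)
    (hmean : ∀ x, ∫ θ in (0:ℝ)..T, k (x, θ) = 0) :
    ∃ h : X × ℝ → E, ContDiff ℝ 1 h ∧ (∀ x, Function.Periodic (fun θ => h (x, θ)) T) ∧
      ∀ x θ, HasDerivAt (fun θ => h (x, θ)) (k (x, θ)) θ := by
  have hkc (x : X) : Continuous fun θ => k (x, θ) := hk.continuous.comp (by fun_prop)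
  refine ⟨fun p => ∫ s in (0:ℝ)..p.2, k (p.1, s), ?_, fun x θ => ?_, fun x θ => ?_⟩
  · have hrw : (fun p : X × ℝ => ∫ s in (0:ℝ)..p.2, k (p.1, s)) =
        fun p => p.2 • ∫ s in (0:ℝ)..1, k (p.1, p.2 * s) := by
      ext p
      rw [smul_integral_comp_mul_left (fun s => k (p.1, s))]
      simp
    rw [hrw]
    refine contDiff_snd.smul (contDiff_one_parametric_intervalIntegral
      (F := fun q : (X × ℝ) × ℝ => k (q.1.1, q.1.2 * q.2)) (hk.comp ?_) 0 1)
    fun_prop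
  · have hi := fun a b => (hkc x).intervalIntegrable (μ := MeasureTheory.volume) a b
    change ∫ s in (0:ℝ)..(θ + T), k (x, s) = ∫ s in (0:ℝ)..θ, k (x, s)
    rw [← integral_add_adjacent_intervals (hi 0 θ) (hi θ (θ + T)),
      (hper x).intervalIntegral_add_eq θ 0, zero_add, hmean, add_zero]
  · exact ((hkc x).integral_hasStrictDerivAt 0 θ).hasDerivAt

/-- A bounded `C¹` solution `u` of the homological equation `ω ∂u/∂θ = k` over a compact set
on which the frequency `ω` does not vanish. -/
theorem exists_bounded_solution_homological_equation
    {X E : Type*} [NormedAddCommGroup X] [NormedSpace ℝ X] [ProperSpace X]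
    [NormedAddCommGroup E] [NormedSpace ℝ E] [CompleteSpace E]
    {k : X × ℝ → E} (hk : ContDiff ℝ 1 k) {T : ℝ} (hT : 0 < T)
    (hper : ∀ x, Function.Periodic (fun θ => k (x, θ)) T)
    (hmean : ∀ x, ∫ θ in (0:ℝ)..T, k (x, θ) = 0)
    {ω : X → ℝ} (hω : ContDiff ℝ 1 ω) {K : Set X} (hK : IsCompact K) (hωK : ∀ x ∈ K, ω x ≠ 0) :
    ∃ u : X × ℝ → E, ∃ M₀ M₁ : ℝ, ∀ x ∈ K, ∀ θ, ‖u (x, θ)‖ ≤ M₀ ∧ ‖fderiv ℝ u (x, θ)‖ ≤ M₁ ∧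
      DifferentiableAt ℝ u (x, θ) ∧ ω x • fderiv ℝ u (x, θ) (0, 1) = k (x, θ) := by
  obtain ⟨h, hh, hhper, hhder⟩ := contDiff_primitive_of_periodic hk hper hmean
  let u : X × ℝ → E := fun p => (ω p.1)⁻¹ • h p
  let S : Set (X × ℝ) := {p | ω p.1 ≠ 0}
  have hS : IsOpen S := isOpen_ne_fun (hω.continuous.comp continuous_fst) continuous_const
  have hKS : K ×ˢ univ ⊆ S := fun p hp => hωK p.1 hp.1
  have hu : ContDiffOn ℝ 1 u S :=
    ((hω.comp contDiff_fst).contDiffOn.inv fun p hp => hp).smul hh.contDiffOn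
  have huper (x : X) : Function.Periodic (fun θ => u (x, θ)) T := fun θ =>
    congrArg ((ω x)⁻¹ • ·) (hhper x θ)
  have hu'per (x : X) : Function.Periodic (fun θ => fderiv ℝ u (x, θ)) T := fun θ => by
    have hshift : (fun p : X × ℝ => u (p + (0, T))) = u := by
      ext ⟨y, s⟩
      simpa using huper y s
    have := fderiv_comp_add_right (𝕜 := ℝ) (f := u) (x := (x, θ)) (0, T)
    rw [hshift] at this
    simpa using this.symm
  obtain ⟨M₀, hM₀⟩ := hK.exists_bound_of_continuousOn_of_periodic
    (hu.continuousOn.mono hKS) hT huper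
  obtain ⟨M₁, hM₁⟩ := hK.exists_bound_of_continuousOn_of_periodic
    ((hu.continuousOn_fderiv_of_isOpen hS le_rfl).mono hKS) hT hu'per
  refine ⟨u, M₀, M₁, fun x hx θ => ?_⟩
  have hd : DifferentiableAt ℝ u (x, θ) :=
    (hu.differentiableOn one_ne_zero).differentiableAt (hS.mem_nhds (hωK x hx))
  refine ⟨hM₀ x hx θ, hM₁ x hx θ, hd, ?_⟩
  have h₁ : HasDerivAt (fun θ => u (x, θ)) (fderiv ℝ u (x, θ) (0, 1)) θ :=
    hd.hasFDerivAt.comp_hasDerivAt θ ((hasDerivAt_const θ x).prodMk (hasDerivAt_id θ))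
  rw [h₁.unique ((hhder x θ).const_smul (ω x)⁻¹), smul_inv_smul₀ (hωK x hx)]

/-- Averaging estimate: if `u` solves the homological equation `ω ∂u/∂θ = g - G` along the
trajectory, then the slow variable stays `ε`-close to the averaged motion on the time
scale `1 / ε`. -/
theorem norm_sub_le_of_homological_equation
    {E : Type*} [NormedAddCommGroup E] [NormedSpace ℝ E]
    {D : Set E} {f : E → ℝ → ℝ} {g : E → ℝ → E} {ω : E → ℝ} {G : E → E} {u : E × ℝ → E}
    {M₀ M₁ B L : ℝ} (hB : 0 ≤ B) (hL : 0 < L) (hM₀ : 0 ≤ M₀) (hM₁ : 0 ≤ M₁)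
    (hu₀ : ∀ x ∈ D, ∀ θ, ‖u (x, θ)‖ ≤ M₀) (hu₁ : ∀ x ∈ D, ∀ θ, ‖fderiv ℝ u (x, θ)‖ ≤ M₁)
    (hud : ∀ x ∈ D, ∀ θ, DifferentiableAt ℝ u (x, θ))
    (hu : ∀ x ∈ D, ∀ θ, ω x • fderiv ℝ u (x, θ) (0, 1) = g x θ - G x)
    (hfg : ∀ x ∈ D, ∀ θ, ‖(g x θ, f x θ)‖ ≤ B)
    (hG : ∀ x ∈ D, ∀ y ∈ D, ‖G x - G y‖ ≤ L * ‖x - y‖)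
    {ε : ℝ} (hε : 0 < ε) {φ : ℝ → ℝ} {I J : ℝ → E}
    (hφ : ∀ t ∈ Icc (0:ℝ) (1 / ε), HasDerivAt φ (ω (I t) + ε * f (I t) (φ t)) t)
    (hI : ∀ t ∈ Icc (0:ℝ) (1 / ε), HasDerivAt I (ε • g (I t) (φ t)) t)
    (hJ : ∀ t ∈ Icc (0:ℝ) (1 / ε), HasDerivAt J (ε • G (J t)) t) (hIJ : J 0 = I 0)
    (hID : ∀ t ∈ Icc (0:ℝ) (1 / ε), I t ∈ D) (hJD : ∀ t ∈ Icc (0:ℝ) (1 / ε), J t ∈ D)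
    {t : ℝ} (ht : t ∈ Icc (0:ℝ) (1 / ε)) :
    ‖I t - J t‖ ≤ (M₀ * exp L + (L * M₀ + M₁ * B) / L * exp L + M₀) * ε := by
  let P : ℝ → E := fun t => I t - ε • u (I t, φ t) - J t
  let P' : ℝ → E := fun t =>
    ε • (G (I t) - G (J t)) - ε ^ 2 • fderiv ℝ u (I t, φ t) (g (I t) (φ t), f (I t) (φ t))
  have hP (t : ℝ) (ht : t ∈ Icc (0:ℝ) (1 / ε)) : HasDerivAt P (P' t) t := by
    have hcomp := (hud _ (hID t ht) (φ t)).hasFDerivAt.comp_hasDerivAt t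
      ((hI t ht).prodMk (hφ t ht))
    have hsplit : ((ε • g (I t) (φ t), ω (I t) + ε * f (I t) (φ t)) : E × ℝ) =
        ω (I t) • (0, 1) + ε • (g (I t) (φ t), f (I t) (φ t)) := by
      simp
    rw [hsplit, map_add, map_smul, map_smul, hu _ (hID t ht)] at hcomp
    refine (((hI t ht).sub (hcomp.const_smul ε)).sub (hJ t ht)).congr_deriv ?_
    simp only [P']
    module
  have hIP (t : ℝ) (ht : t ∈ Icc (0:ℝ) (1 / ε)) : ‖I t - J t‖ ≤ ‖P t‖ + ε * M₀ := by
    have hsplit : I t - J t = P t + ε • u (I t, φ t) := by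
      simp only [P]
      abel
    rw [hsplit]
    refine (norm_add_le _ _).trans ?_
    rw [norm_smul, norm_of_nonneg hε.le]
    gcongr
    exact hu₀ _ (hID t ht) _
  have h0 : (0:ℝ) ∈ Icc (0:ℝ) (1 / ε) := ⟨le_rfl, by positivity⟩
  have hP0 : ‖P 0‖ ≤ ε * M₀ := by
    simp only [P, hIJ, norm_neg, sub_right_comm _ _ (I 0), sub_self, zero_sub,
      norm_smul, norm_of_nonneg hε.le]
    gcongr
    exact hu₀ _ (hID 0 h0) _
  have hbound (t : ℝ) (ht : t ∈ Icc (0:ℝ) (1 / ε)) :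
      ‖P' t‖ ≤ (ε * L) * ‖P t‖ + ε ^ 2 * (L * M₀ + M₁ * B) := by
    have h₁ : ‖G (I t) - G (J t)‖ ≤ L * (‖P t‖ + ε * M₀) :=
      (hG _ (hID t ht) _ (hJD t ht)).trans (by gcongr; exact hIP t ht)
    have h₂ : ‖fderiv ℝ u (I t, φ t) (g (I t) (φ t), f (I t) (φ t))‖ ≤ M₁ * B :=
      ContinuousLinearMap.le_of_opNorm_le_of_le _ (hu₁ _ (hID t ht) _) (hfg _ (hID t ht) _)
    calc ‖P' t‖ ≤ ε * ‖G (I t) - G (J t)‖ +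
          ε ^ 2 * ‖fderiv ℝ u (I t, φ t) (g (I t) (φ t), f (I t) (φ t))‖ := by
          refine (norm_sub_le _ _).trans_eq ?_
          rw [norm_smul, norm_smul, norm_of_nonneg hε.le, norm_of_nonneg (sq_nonneg ε)]
      _ ≤ ε * (L * (‖P t‖ + ε * M₀)) + ε ^ 2 * (M₁ * B) := by gcongr
      _ = _ := by ring
  have hgron := norm_le_gronwallBound_of_norm_deriv_right_le
    (fun t ht => (hP t ht).continuousAt.continuousWithinAt)
    (fun t ht => (hP t (Ico_subset_Icc_self ht)).hasDerivWithinAt) hP0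
    (fun t ht => hbound t (Ico_subset_Icc_self ht)) t ht
  rw [gronwallBound_of_K_ne_0 (mul_pos hε hL).ne', sub_zero] at hgron
  have hexp : exp (ε * L * t) ≤ exp L := by
    refine exp_le_exp.2 ?_
    have : t * ε ≤ 1 := (le_div_iff₀ hε).1 ht.2
    nlinarith
  have hdiv : ε ^ 2 * (L * M₀ + M₁ * B) / (ε * L) = ε * ((L * M₀ + M₁ * B) / L) := by
    field_simp
  rw [hdiv] at hgron
  calc ‖I t - J t‖ ≤ ‖P t‖ + ε * M₀ := hIP t ht
    _ ≤ (ε * M₀ * exp (ε * L * t) +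
          ε * ((L * M₀ + M₁ * B) / L) * (exp (ε * L * t) - 1)) + ε * M₀ := by gcongr
    _ ≤ (ε * M₀ * exp L + ε * ((L * M₀ + M₁ * B) / L) * exp L) + ε * M₀ := by
        gcongr
        linarith
    _ = _ := by ring

/-- A first integral of a vector field is constant along its trajectories. -/
theorem eq_of_hasDerivAt_of_fderiv_eq_zero
    {E : Type*} [NormedAddCommGroup E] [NormedSpace ℝ E] {D : Set E} {G : E → E} {F : E → ℝ}
    (hF : ∀ x ∈ D, DifferentiableAt ℝ F x) (hint : ∀ x ∈ D, fderiv ℝ F x (G x) = 0)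
    {ε b : ℝ} {J : ℝ → E} (hJ : ∀ t ∈ Icc 0 b, HasDerivAt J (ε • G (J t)) t)
    (hJD : ∀ t ∈ Icc 0 b, J t ∈ D) {t : ℝ} (ht : t ∈ Icc 0 b) : F (J t) = F (J 0) := by
  have hd (t : ℝ) (ht : t ∈ Icc 0 b) : HasDerivAt (fun t => F (J t)) 0 t := by
    have := (hF _ (hJD t ht)).hasFDerivAt.comp_hasDerivAt t (hJ t ht)
    rwa [map_smul, hint _ (hJD t ht), smul_zero] at this
  exact constant_of_has_deriv_right_zero
    (fun t ht => (hd t ht).continuousAt.continuousWithinAt)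
    (fun t ht => (hd t (Ico_subset_Icc_self ht)).hasDerivWithinAt) t ht

/-- **Adiabatic invariants for one-frequency systems.**
With the setup of the classical averaging theorem (`D ⊆ ℝⁿ` open bounded, `f`, `g` smooth and
`2π`-periodic in the angle, `ω ≥ 1/c > 0` on `closure D`, averaged field
`G(J) = (1/2π)∫₀^{2π} g(J,θ) dθ`), if `J_O : ℝⁿ → ℝ` is `λ`-Lipschitz on `closure D`, `C¹` on
`D`, and a first integral of `G` (`dJ_O(x)(G x) = 0` on `D`), then there are `C > 0`, `ε₀ > 0`
such that for `0 < ε ≤ ε₀`, along any solution `(φ, I)` of the perturbed system with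
`I 0 ∈ D` for which `I` and the averaged solution `J` (with `J 0 = I 0`) remain in `D` on
`[0, 1/ε]`, one has `|J_O(I t) - J_O(I 0)| ≤ C ε` on `[0, 1/ε]`. -/
theorem adiabatic_invariant_one_frequency
    (n : ℕ) (D : Set (EuclideanSpace ℝ (Fin n))) (hD : IsOpen D) (hDb : Bornology.IsBounded D)
    (f : EuclideanSpace ℝ (Fin n) → ℝ → ℝ)
    (g : EuclideanSpace ℝ (Fin n) → ℝ → EuclideanSpace ℝ (Fin n))
    (ω : EuclideanSpace ℝ (Fin n) → ℝ)
    (hf : ContDiff ℝ (⊤ : ℕ∞) (fun p : EuclideanSpace ℝ (Fin n) × ℝ => f p.1 p.2))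
    (hg : ContDiff ℝ (⊤ : ℕ∞) (fun p : EuclideanSpace ℝ (Fin n) × ℝ => g p.1 p.2))
    (hω : ContDiff ℝ (⊤ : ℕ∞) ω)
    (hfper : ∀ x θ, f x (θ + 2 * π) = f x θ)
    (hgper : ∀ x θ, g x (θ + 2 * π) = g x θ)
    (c : ℝ) (hc : 0 < c) (hωpos : ∀ x ∈ closure D, 1 / c ≤ ω x)
    (G : EuclideanSpace ℝ (Fin n) → EuclideanSpace ℝ (Fin n))
    (hG : ∀ J, G J = (2 * π)⁻¹ • ∫ θ in (0:ℝ)..(2 * π), g J θ)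
    (J_O : EuclideanSpace ℝ (Fin n) → ℝ) (lam : NNReal)
    (hJlip : LipschitzOnWith lam J_O (closure D))
    (hJC1 : ContDiffOn ℝ 1 J_O D)
    (hJint : ∀ x ∈ D, fderiv ℝ J_O x (G x) = 0) :
    ∃ C > 0, ∃ ε₀ > 0, ∀ ε ∈ Ioc (0:ℝ) ε₀,
      ∀ (φ : ℝ → ℝ) (I J : ℝ → EuclideanSpace ℝ (Fin n)),
        (∀ t ∈ Icc (0:ℝ) (1 / ε), HasDerivAt φ (ω (I t) + ε * f (I t) (φ t)) t) →
        (∀ t ∈ Icc (0:ℝ) (1 / ε), HasDerivAt I (ε • g (I t) (φ t)) t) →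
        (∀ t ∈ Icc (0:ℝ) (1 / ε), HasDerivAt J (ε • G (J t)) t) →
        J 0 = I 0 → I 0 ∈ D →
        (∀ t ∈ Icc (0:ℝ) (1 / ε), I t ∈ D) →
        (∀ t ∈ Icc (0:ℝ) (1 / ε), J t ∈ D) →
        ∀ t ∈ Icc (0:ℝ) (1 / ε), |J_O (I t) - J_O (I 0)| ≤ C * ε := by
  have hK : IsCompact (closure D) := hDb.isCompact_closure
  have hg₁ : ContDiff ℝ 1 fun p : EuclideanSpace ℝ (Fin n) × ℝ => g p.1 p.2 :=
    hg.of_le (by exact_mod_cast le_top)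
  have hf₁ : ContDiff ℝ 1 fun p : EuclideanSpace ℝ (Fin n) × ℝ => f p.1 p.2 :=
    hf.of_le (by exact_mod_cast le_top)
  have hω₁ : ContDiff ℝ 1 ω := hω.of_le (by exact_mod_cast le_top)
  have hG₁ : ContDiff ℝ 1 G := by
    rw [funext hG]
    exact (contDiff_one_parametric_intervalIntegral hg₁ 0 (2 * π)).const_smul _
  have hmean (x : EuclideanSpace ℝ (Fin n)) : ∫ θ in (0:ℝ)..(2 * π), (g x θ - G x) = 0 := by
    have hgx : Continuous fun θ => g x θ :=
      hg₁.continuous.comp (by fun_prop : Continuous fun θ : ℝ => (x, θ))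
    rw [integral_sub (hgx.intervalIntegrable _ _) intervalIntegrable_const, integral_const, hG,
      sub_zero, smul_inv_smul₀ two_pi_pos.ne', sub_self]
  obtain ⟨u, M₀, M₁, hu⟩ := exists_bounded_solution_homological_equation
    (k := fun p : EuclideanSpace ℝ (Fin n) × ℝ => g p.1 p.2 - G p.1)
    (hg₁.sub (hG₁.comp contDiff_fst)) two_pi_pos (fun x θ => by simp only [hgper]) hmean hω₁ hK
    (fun x hx => ((one_div_pos.2 hc).trans_le (hωpos x hx)).ne')
  obtain ⟨B, hB⟩ := hK.exists_bound_of_continuousOn_of_periodic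
    (u := fun p : EuclideanSpace ℝ (Fin n) × ℝ => (g p.1 p.2, f p.1 p.2))
    (hg₁.continuous.prodMk hf₁.continuous).continuousOn two_pi_pos
    (fun x θ => by simp only [hgper, hfper])
  obtain ⟨R, hR⟩ := hDb.subset_closedBall 0
  obtain ⟨L, hL⟩ := hG₁.contDiffOn.exists_lipschitzOnWith one_ne_zero
    (convex_closedBall (0 : EuclideanSpace ℝ (Fin n)) R) (isCompact_closedBall 0 R)
  let A : ℝ := |M₀| * exp (L + 1) + ((L + 1) * |M₀| + |M₁| * |B|) / (L + 1) * exp (L + 1) + |M₀|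
  have hA : 0 ≤ A := by positivity
  refine ⟨lam * A + 1, by positivity, 1, one_pos, fun ε hε φ I J hφ hI hJ hIJ _ hID hJD t ht => ?_⟩
  have hconst : J_O (J t) = J_O (I 0) := by
    rw [← hIJ]
    exact eq_of_hasDerivAt_of_fderiv_eq_zero
      (fun x hx => (hJC1.differentiableOn one_ne_zero).differentiableAt (hD.mem_nhds hx))
      hJint hJ hJD ht
  have hclose : ‖I t - J t‖ ≤ A * ε := by
    refine norm_sub_le_of_homological_equation (abs_nonneg B) (by positivity) (abs_nonneg M₀)
      (abs_nonneg M₁)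
      (fun x hx θ => (hu x (subset_closure hx) θ).1.trans (le_abs_self _))
      (fun x hx θ => (hu x (subset_closure hx) θ).2.1.trans (le_abs_self _))
      (fun x hx θ => (hu x (subset_closure hx) θ).2.2.1)
      (fun x hx θ => (hu x (subset_closure hx) θ).2.2.2)
      (fun x hx θ => (hB x (subset_closure hx) θ).trans (le_abs_self _))
      (fun x hx y hy => ?_) hε.1 hφ hI hJ hIJ hID hJD ht
    refine (hL.norm_sub_le (hR hx) (hR hy)).trans ?_
    gcongr
    linarith
  rw [← hconst]
  calc |J_O (I t) - J_O (J t)| ≤ lam * ‖I t - J t‖ :=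
        hJlip.norm_sub_le (subset_closure (hID t ht)) (subset_closure (hJD t ht))
    _ ≤ lam * (A * ε) := by gcongr
    _ ≤ (lam * A + 1) * ε := by linarith [hε.1]
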